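/- arXiv:1304.0428 — 3 statements merged into one kernel-verified Lean document; each statement's English description precedes it below -/
import Mathlib

section
/- Let G be a locally finite connected simple graph with vertex set X equipped with the graph metric d, and let z ∈ X with deg(z) > 1 such that z is not a vertex of any triangle (i.e., no two neighbors of z are adjacent to each other). If f : X → ℝ is convex at z, then f is subharmonic at z, i.e., f(z) ≤ (1/deg(z)) Σ_{y ∼ z} f(y). -/
/-- `f` is subharmonic at `z`: its value is at most the average of its values
over the neighbors of `z`. -/
def SubharmonicAt {X : Type*} (G : SimpleGraph X) [∀ v, Fintype (G.neighborSet v)]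
    (f : X → ℝ) (z : X) : Prop :=
  f z ≤ (1 / (G.degree z : ℝ)) * ∑ y ∈ G.neighborFinset z, f y

/-- `f` is convex at `z` with respect to the graph metric `G.dist`:
whenever `z` lies between `x` and `y`,
`d(x,y) f(z) ≤ d(y,z) f(x) + d(x,z) f(y)`. -/
def ConvexAt {X : Type*} (G : SimpleGraph X) (f : X → ℝ) (z : X) : Prop :=
  ∀ x y : X, G.dist x y = G.dist x z + G.dist z y →
    (G.dist x y : ℝ) * f z ≤ (G.dist y z : ℝ) * f x + (G.dist x z : ℝ) * f y

/-- If the mean of any two values of `f` at distinct points of `s` is at least `c`, then so is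
the mean of `f` over `s`. -/
theorem Finset.card_mul_le_sum_of_pairwise {ι : Type*} {s : Finset ι} (hs : 1 < s.card)
    {f : ι → ℝ} {c : ℝ} (h : ∀ a ∈ s, ∀ b ∈ s, a ≠ b → 2 * c ≤ f a + f b) :
    s.card * c ≤ ∑ a ∈ s, f a := by
  classical
  have h1 : (1 : ℝ) < s.card := by exact_mod_cast hs
  have key : ∀ a ∈ s, ((s.card : ℝ) - 1) * (2 * c) ≤
      ((s.card : ℝ) - 2) * f a + ∑ b ∈ s, f b := by
    intro a ha
    have hle : ∑ _b ∈ s.erase a, 2 * c ≤ ∑ b ∈ s.erase a, (f a + f b) :=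
      Finset.sum_le_sum fun b hb =>
        h a ha b (Finset.mem_of_mem_erase hb) (Finset.ne_of_mem_erase hb).symm
    have hsum := Finset.add_sum_erase s f ha
    have hcard : ((s.erase a).card : ℝ) = s.card - 1 := by
      rw [Finset.card_erase_of_mem ha, Nat.cast_sub hs.le, Nat.cast_one]
    rw [Finset.sum_add_distrib, Finset.sum_const, Finset.sum_const, nsmul_eq_mul, nsmul_eq_mul,
      hcard] at hle
    linarith
  have total := Finset.sum_le_sum key
  rw [Finset.sum_add_distrib, Finset.sum_const, Finset.sum_const, ← Finset.mul_sum,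
    nsmul_eq_mul, nsmul_eq_mul] at total
  refine le_of_mul_le_mul_left ?_ (sub_pos.2 h1)
  linarith

/-- Distinct non-adjacent vertices with a common neighbor are at distance two. -/
theorem SimpleGraph.Adj.dist_eq_two {X : Type*} {G : SimpleGraph X} {z a b : X}
    (ha : G.Adj z a) (hb : G.Adj z b) (hne : a ≠ b) (hab : ¬ G.Adj a b) : G.dist a b = 2 := by
  let p : G.Walk a b := .cons ha.symm (.cons hb .nil)
  exact le_antisymm (G.dist_le p) (p.reachable.one_lt_dist_of_ne_of_not_adj hne hab)

theorem subharmonicAt_of_convexAt {X : Type*} (G : SimpleGraph X)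
    [∀ v, Fintype (G.neighborSet v)]
    (hconn : G.Connected) (z : X) (hdeg : 1 < G.degree z)
    (htri : ∀ a b : X, G.Adj z a → G.Adj z b → ¬ G.Adj a b)
    (f : X → ℝ) (hf : ConvexAt G f z) :
    SubharmonicAt G f z := by
  have hpair : ∀ a ∈ G.neighborFinset z, ∀ b ∈ G.neighborFinset z, a ≠ b →
      2 * f z ≤ f a + f b := by
    intro a ha b hb hne
    rw [SimpleGraph.mem_neighborFinset] at ha hb
    have haz : G.dist a z = 1 := SimpleGraph.dist_eq_one_iff_adj.2 ha.symm
    have hzb : G.dist z b = 1 := SimpleGraph.dist_eq_one_iff_adj.2 hb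
    have hbz : G.dist b z = 1 := SimpleGraph.dist_eq_one_iff_adj.2 hb.symm
    have hab := ha.dist_eq_two hb hne (htri a b ha hb)
    simpa [haz, hbz, hab] using hf a b (by rw [hab, haz, hzb])
  have hpos : (0 : ℝ) < G.degree z := by exact_mod_cast zero_lt_one.trans hdeg
  have hmean : G.degree z * f z ≤ ∑ y ∈ G.neighborFinset z, f y :=
    Finset.card_mul_le_sum_of_pairwise hdeg hpair
  rw [SubharmonicAt, one_div_mul_eq_div, le_div_iff₀ hpos, mul_comm]
  exact hmean
end

section
/- Let X be a normed abelian group (a (semi)normed additive commutative group whose norm induces its metric), fix r > 0, and consider the weighted graph on X compatible with the norm: x ∼ y iff x ≠ y and ‖x − y‖ ≤ r, with edge weights e(x,y) = ‖x − y‖; assume the graph is locally finite (each ball B_r(x) = {y : y ∼ x} is finite). If f : X → ℝ is midpoint convex, i.e., f(x) ≤ ½ f(x+z) + ½ f(x−z) for all x, z ∈ X, then f is subharmonic at every x ∈ X: f(x) · Σ_{y ∼ x} ‖x − y‖ ≤ Σ_{y ∼ x} ‖x − y‖ f(y). -/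
theorem subharmonic_of_midpointConvex {X : Type*} [NormedAddCommGroup X]
    (r : ℝ) (hr : 0 < r)
    (hfin : ∀ x : X, {y : X | y ≠ x ∧ ‖x - y‖ ≤ r}.Finite)
    (f : X → ℝ)
    (hmc : ∀ x z : X, f x ≤ (1 / 2) * f (x + z) + (1 / 2) * f (x - z)) :
    ∀ x : X, f x * ∑ y ∈ (hfin x).toFinset, ‖x - y‖ ≤
      ∑ y ∈ (hfin x).toFinset, ‖x - y‖ * f y := by
  intro x
  have norm_reflect (y : X) : ‖x - (x + x - y)‖ = ‖x - y‖ := by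
    rw [norm_sub_rev x y]
    congr 1
    abel
  have sum_reflect : ∑ y ∈ (hfin x).toFinset, ‖x - y‖ * f (x + x - y) =
      ∑ y ∈ (hfin x).toFinset, ‖x - y‖ * f y := by
    have maps_to : ∀ y ∈ (hfin x).toFinset, x + x - y ∈ (hfin x).toFinset := by
      intro y hy
      simp only [Set.Finite.mem_toFinset, Set.mem_ofPred_eq, norm_reflect] at hy ⊢
      refine ⟨fun h => hy.1 ?_, hy.2⟩
      rw [add_sub_assoc, add_eq_left, sub_eq_zero] at h
      exact h.symm
    refine Finset.sum_nbij' (fun y => x + x - y) (fun y => x + x - y) maps_to maps_to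
      (fun y _ => sub_sub_cancel _ _) (fun y _ => sub_sub_cancel _ _) fun y _ => ?_
    rw [norm_reflect]
  have sum_le : ∑ y ∈ (hfin x).toFinset, ‖x - y‖ * f x ≤
      ∑ y ∈ (hfin x).toFinset,
        ((1 / 2) * (‖x - y‖ * f (x + x - y)) + (1 / 2) * (‖x - y‖ * f y)) := by
    refine Finset.sum_le_sum fun y _ => ?_
    have h := hmc x (x - y)
    rw [← add_sub_assoc, sub_sub_cancel] at h
    linarith [mul_le_mul_of_nonneg_left h (norm_nonneg (x - y))]
  rw [Finset.sum_add_distrib, ← Finset.mul_sum, ← Finset.mul_sum, sum_reflect,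
    ← Finset.sum_mul] at sum_le
  linarith
end

section
/- Let X be a normed abelian group and let F be a nonempty subset of X such that for every x ∈ X the infimum d(x, F) = inf{‖x − y‖ : y ∈ F} is attained by some point of F. Suppose F has the nearest neighbor property: for all y₁, y₂ ∈ F and all z ∈ X there exists y ∈ F with 2‖y − z‖ ≤ ‖y₁ + y₂ − 2z‖. Then the distance function x ↦ d(x, F) is midpoint convex: 2 d(x, F) ≤ d(x + z, F) + d(x − z, F) for all x, z ∈ X. -/
theorem infDist_midpointConvex_of_nearestNeighbor {X : Type*} [NormedAddCommGroup X]
    (F : Set X) (hne : F.Nonempty)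
    (hatt : ∀ x : X, ∃ y ∈ F, Metric.infDist x F = ‖x - y‖)
    (hnn : ∀ y₁ ∈ F, ∀ y₂ ∈ F, ∀ z : X, ∃ y ∈ F, 2 * ‖y - z‖ ≤ ‖y₁ + y₂ - 2 • z‖) :
    ∀ x z : X, 2 * Metric.infDist x F ≤
      Metric.infDist (x + z) F + Metric.infDist (x - z) F := by
  intro x z
  obtain ⟨y₁, hy₁, h₁⟩ := hatt (x + z)
  obtain ⟨y₂, hy₂, h₂⟩ := hatt (x - z)
  obtain ⟨y, hy, h⟩ := hnn y₁ hy₁ y₂ hy₂ x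
  calc 2 * Metric.infDist x F ≤ 2 * ‖y - x‖ := by
        gcongr
        rw [← dist_eq_norm, dist_comm]
        exact Metric.infDist_le_dist_of_mem hy
    _ ≤ ‖y₁ + y₂ - 2 • x‖ := h
    _ = ‖(x + z - y₁) + (x - z - y₂)‖ := by
        rw [← norm_neg]
        congr 1
        abel
    _ ≤ ‖x + z - y₁‖ + ‖x - z - y₂‖ := norm_add_le _ _
    _ = Metric.infDist (x + z) F + Metric.infDist (x - z) F := by rw [h₁, h₂]
end
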